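/- For every prime power q, every integer s with 0 ≤ s < q, every integer θ with 0 ≤ θ ≤ q − s + 1, and every integer Δ with 0 ≤ Δ < q − s, there exists a symmetric configuration v_k with v = q² − q·s + θ and k = q − s − Δ. -/

import Mathlib

/-- A 0,1-matrix (given as a `Bool`-valued function) contains no 2×2 all-ones
submatrix: there are no two distinct row indices and two distinct column
indices such that all four corresponding entries are 1. -/
def NoRect {α β : Type*} (M : α → β → Bool) : Prop :=
  ∀ i₁ i₂ j₁ j₂, i₁ ≠ i₂ → j₁ ≠ j₂ →
    M i₁ j₁ = true → M i₁ j₂ = true → M i₂ j₁ = true → M i₂ j₂ = true → False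

/-- `M` is an incidence matrix of a symmetric configuration with parameter `k`:
every row and every column contains exactly `k` ones, and there is no
2×2 all-ones submatrix. -/
def IsIncidence {α β : Type*} [Fintype α] [Fintype β]
    (k : ℕ) (M : α → β → Bool) : Prop :=
  (∀ i : α, (Finset.univ.filter (fun j => M i j = true)).card = k) ∧
  (∀ j : β, (Finset.univ.filter (fun i => M i j = true)).card = k) ∧
  NoRect M

/-- A symmetric configuration `v_k` exists: there is a `v × v` 0,1-matrix with
exactly `k` ones in every row and column and no 2×2 all-ones submatrix. -/
def ConfigExists (v k : ℕ) : Prop :=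
  ∃ M : Fin v → Fin v → Bool, IsIncidence k M

/-- `A` is a `(v,k)` modular Golomb ruler: a `k`-element subset of `ℤ/vℤ`
such that all differences `a - a'` with `a ≠ a'` in `A` are nonzero and
pairwise distinct. -/
def IsModularGolombRuler (v k : ℕ) (A : Finset (ZMod v)) : Prop :=
  A.card = k ∧
  (∀ a ∈ A, ∀ a' ∈ A, a ≠ a' → a - a' ≠ 0) ∧
  (∀ a ∈ A, ∀ a' ∈ A, ∀ b ∈ A, ∀ b' ∈ A, a ≠ a' → b ≠ b' →
    a - a' = b - b' → a = b ∧ a' = b')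

/-- `a` is a Golomb ruler of order `k`: `k` nonnegative integers in strictly
increasing order all of whose differences `a i - a j` with `i ≠ j` are
pairwise distinct. -/
def IsGolombRuler (k : ℕ) (a : Fin k → ℤ) : Prop :=
  (∀ i, 0 ≤ a i) ∧ StrictMono a ∧
  (∀ i j i' j' : Fin k, i ≠ j → i' ≠ j' → a i - a j = a i' - a j' → i = i' ∧ j = j')


/-- Removing a perfect matching (Hall) lowers `k` by one. -/
lemma peel_one {v k : ℕ} (h : ConfigExists v (k + 1)) : ConfigExists v k := by
  obtain ⟨M, hr, hc, hn⟩ := h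
  have hall : ∀ s : Finset (Fin v),
      s.card ≤ (s.biUnion (fun i => Finset.univ.filter (fun j => M i j = true))).card := by
    intro s
    set t := s.biUnion (fun i => Finset.univ.filter (fun j => M i j = true)) with ht
    have h1 : s.card * (k + 1) ≤ t.card * (k + 1) := by
      refine Finset.card_mul_le_card_mul (fun i j => M i j = true) ?_ ?_
      · intro i hi
        rw [← hr i]
        apply Finset.card_le_card
        intro j hj
        simp only [Finset.mem_filter, Finset.mem_univ, true_and] at hj
        simp only [Finset.bipartiteAbove, Finset.mem_filter]
        exact ⟨by rw [ht]; simp only [Finset.mem_biUnion, Finset.mem_filter]; exact ⟨i, hi, Finset.mem_univ _, hj⟩, hj⟩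
      · intro j hj
        rw [← hc j]
        apply Finset.card_le_card
        intro i hi
        simp only [Finset.bipartiteBelow, Finset.mem_filter] at hi
        simpa using hi.2
    exact Nat.le_of_mul_le_mul_right h1 (Nat.succ_pos k)
  obtain ⟨f, hf, hfm⟩ := (Finset.all_card_le_biUnion_card_iff_exists_injective _).1 hall
  have hb : Function.Bijective f := Finite.injective_iff_bijective.1 hf
  have hfm' : ∀ i, M i (f i) = true := fun i => by simpa using hfm i
  refine ⟨fun i j => M i j && decide (j ≠ f i), ?_, ?_, ?_⟩
  · intro i
    have : (Finset.univ.filter (fun j => (M i j && decide (j ≠ f i)) = true))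
        = (Finset.univ.filter (fun j => M i j = true)).erase (f i) := by
      ext j; simp [and_comm]
    rw [this, Finset.card_erase_of_mem (by simpa using hfm' i), hr]; rfl
  · intro j
    obtain ⟨i₀, rfl⟩ := hb.2 j
    have : (Finset.univ.filter (fun i => (M i (f i₀) && decide (f i₀ ≠ f i)) = true))
        = (Finset.univ.filter (fun i => M i (f i₀) = true)).erase i₀ := by
      ext j; simp only [Finset.mem_filter, Finset.mem_univ, true_and, Bool.and_eq_true, decide_eq_true_eq, Finset.mem_erase, ne_eq, hf.eq_iff]; grind
    rw [this, Finset.card_erase_of_mem (by simpa using hfm' i₀), hc]; rfl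
  · intro i₁ i₂ j₁ j₂ hi hj h1 h2 h3 h4
    simp only [Bool.and_eq_true] at h1 h2 h3 h4
    exact hn i₁ i₂ j₁ j₂ hi hj h1.1 h2.1 h3.1 h4.1

lemma peel_many {v k : ℕ} (d : ℕ) (h : ConfigExists v (k + d)) : ConfigExists v k := by
  induction d with
  | zero => exact h
  | succ d ih => exact ih (peel_one h)

lemma config_of_types {α β : Type*} [Fintype α] [Fintype β] {v k : ℕ}
    (hα : Fintype.card α = v) (hβ : Fintype.card β = v) (M : α → β → Bool)
    (h : IsIncidence k M) : ConfigExists v k := by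
  let ea := (Fintype.equivFinOfCardEq hα).symm
  let eb := (Fintype.equivFinOfCardEq hβ).symm
  obtain ⟨hr, hc, hn⟩ := h
  refine ⟨fun i j => M (ea i) (eb j), ?_, ?_, ?_⟩
  · intro i
    rw [← hr (ea i)]
    exact Finset.card_equiv eb (by simp)
  · intro j
    rw [← hc (eb j)]
    exact Finset.card_equiv ea (by simp)
  · intro i₁ i₂ j₁ j₂ hi hj
    exact hn _ _ _ _ (ea.injective.ne hi) (eb.injective.ne hj)

/-- Incidence between the added points and the added lines. -/
def newRel (K θ : ℕ) (i j : Fin θ) : Prop :=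
  if θ ≤ K then i = j else ((i.val = K ∧ j.val ≠ K) ∨ (i.val ≠ K ∧ j.val = K))

/-- The extended incidence relation. -/
def extRel {F : Type*} [Field F] (K θ : ℕ) (S : Finset F) (f : Fin K → Fin K → F) :
    (Fin K × F) ⊕ Fin θ → (Fin K × F) ⊕ Fin θ → Prop
  | .inl (a, y), .inl (b, c) => y - c = f a b ∧ ¬ (a = b ∧ a.val < θ ∧ y ∈ S)
  | .inl (a, y), .inr i => a.val = i.val ∧ y ∈ S
  | .inr i, .inl (b, c) => b.val = i.val ∧ c ∈ S
  | .inr i, .inr j => newRel K θ i j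

lemma extRel_ll {F : Type*} [Field F] {K θ : ℕ} {S : Finset F} {f : Fin K → Fin K → F}
    (a b : Fin K) (y c : F) : extRel K θ S f (.inl (a, y)) (.inl (b, c)) ↔
      (y - c = f a b ∧ ¬ (a = b ∧ a.val < θ ∧ y ∈ S)) := by
  constructor <;> exact fun h => h

lemma extRel_lr {F : Type*} [Field F] {K θ : ℕ} {S : Finset F} {f : Fin K → Fin K → F}
    (a : Fin K) (y : F) (i : Fin θ) : extRel K θ S f (.inl (a, y)) (.inr i) ↔
      (a.val = i.val ∧ y ∈ S) := by
  constructor <;> exact fun h => h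

lemma extRel_rl {F : Type*} [Field F] {K θ : ℕ} {S : Finset F} {f : Fin K → Fin K → F}
    (b : Fin K) (c : F) (i : Fin θ) : extRel K θ S f (.inr i) (.inl (b, c)) ↔
      (b.val = i.val ∧ c ∈ S) := by
  constructor <;> exact fun h => h

lemma extRel_rr {F : Type*} [Field F] {K θ : ℕ} {S : Finset F} {f : Fin K → Fin K → F}
    (i j : Fin θ) : extRel K θ S f (.inr i) (.inr j) ↔ newRel K θ i j := by
  constructor <;> exact fun h => h

lemma newRel_symm {K θ : ℕ} (i j : Fin θ) : newRel K θ i j ↔ newRel K θ j i := by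
  unfold newRel
  split_ifs
  · exact eq_comm
  · tauto

lemma extRel_swap {F : Type*} [Field F] {K θ : ℕ} {S : Finset F} {f : Fin K → Fin K → F}
    (hf : ∀ a, f a a = 0) (u w : (Fin K × F) ⊕ Fin θ) :
    extRel K θ S f u w ↔ extRel K θ S (fun a b => - f b a) w u := by
  rcases u with ⟨a, y⟩ | i <;> rcases w with ⟨b, c⟩ | j
  · simp only [extRel]
    by_cases hab : a = b
    · subst hab
      simp only [hf, sub_eq_zero, neg_zero]
      constructor
      · rintro ⟨rfl, h⟩; exact ⟨rfl, h⟩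
      · rintro ⟨rfl, h⟩; exact ⟨rfl, h⟩
    · have : b ≠ a := fun h => hab h.symm
      simp only [hab, this, false_and, not_false_eq_true, and_true]
      rw [← neg_sub, neg_eq_iff_eq_neg]
  · simp only [extRel]
  · simp only [extRel]
  · exact newRel_symm i j

open Classical in
lemma newRel_count {K θ : ℕ} (hθ : θ ≤ K + 1) (i : Fin θ) :
    (Finset.univ.filter (fun j => newRel K θ i j)).card = if i.val = K then K else 1 := by
  unfold newRel
  by_cases h : θ ≤ K
  · have : i.val ≠ K := by have := i.isLt; omega
    simp only [h, if_true, this, if_false]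
    rw [Finset.card_eq_one]
    exact ⟨i, by ext j; simp [eq_comm]⟩
  · obtain rfl : θ = K + 1 := by omega
    simp only [h, if_false]
    by_cases hi : i.val = K
    · have : (Finset.univ.filter (fun j : Fin (K+1) =>
          ((i.val = K ∧ j.val ≠ K) ∨ (i.val ≠ K ∧ j.val = K)))) = Finset.univ.erase (Fin.last K) := by
        ext j; simp [hi, Fin.ext_iff]
      rw [this, if_pos hi, Finset.card_erase_of_mem (Finset.mem_univ _)]
      simp
    · rw [if_neg hi, Finset.card_eq_one]
      exact ⟨Fin.last K, by ext j; simp [hi, Fin.ext_iff]⟩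

open Classical in
lemma ext_row {F : Type*} [Field F] [Fintype F] {K θ : ℕ} (hθ : θ ≤ K + 1) (hK : 0 < K)
    {S : Finset F} (hS : S.card + 1 = K) (f : Fin K → Fin K → F) (u : (Fin K × F) ⊕ Fin θ) :
    (Finset.univ.filter (fun w => extRel K θ S f u w)).card = K := by
  rw [Finset.card_filter, Fintype.sum_sum_type, Fintype.sum_prod_type]
  rcases u with ⟨a, y⟩ | i
  · simp only [extRel_ll, extRel_lr]
    have h1 : ∀ b : Fin K, (∑ c : F, if (y - c = f a b ∧ ¬ (a = b ∧ a.val < θ ∧ y ∈ S)) then 1 else 0)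
        = if (a = b ∧ a.val < θ ∧ y ∈ S) then 0 else 1 := by
      intro b
      by_cases h : (a = b ∧ a.val < θ ∧ y ∈ S)
      · rw [if_pos h]
        exact Finset.sum_eq_zero fun c _ => if_neg fun hc => hc.2 h
      · simp only [h, not_false_eq_true, and_true, if_false]
        rw [Finset.sum_eq_single (y - f a b)]
        · simp
        · intro c _ hc
          rw [if_neg]
          intro h; apply hc; rw [← h]; ring
        · simp
    simp only [h1]
    by_cases h : a.val < θ ∧ y ∈ S
    · simp only [h.1, h.2, and_true]
      have h2 : (∑ b : Fin K, if a = b then 0 else 1) = K - 1 := by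
        have h4 : (∑ b : Fin K, if a = b then 0 else 1)
            = (Finset.univ.erase a : Finset (Fin K)).card := by
          rw [Finset.card_eq_sum_ones, ← Finset.add_sum_erase _ _ (Finset.mem_univ a), if_pos rfl,
            zero_add]
          refine Finset.sum_congr rfl fun b hb => ?_
          rw [if_neg (Finset.ne_of_mem_erase hb).symm]
        rw [h4, Finset.card_erase_of_mem (Finset.mem_univ _)]
        simp
      have h3 : (∑ i : Fin θ, if a.val = i.val then 1 else 0) = 1 := by
        rw [Finset.sum_eq_single (⟨a.val, h.1⟩ : Fin θ)]
        · simp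
        · intro c _ hc
          rw [if_neg]
          intro h; apply hc; ext; exact h.symm
        · simp
      rw [h2, h3]; omega
    · have h2 : ∀ b : Fin K, ¬ (a = b ∧ a.val < θ ∧ y ∈ S) := fun b hb => h hb.2
      have h3 : ∀ i : Fin θ, ¬ (a.val = i.val ∧ y ∈ S) := by
        intro i hi
        exact h ⟨by rw [hi.1]; exact i.isLt, hi.2⟩
      simp [h2, h3]
  · simp only [extRel_rl, extRel_rr]
    rw [← Finset.card_filter (fun j => newRel K θ i j), newRel_count hθ]
    by_cases hi : i.val = K
    · have : ∀ b : Fin K, b.val ≠ i.val := fun b => by have := b.isLt; omega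
      simp [hi, this]
      intro b hb; have := b.isLt; omega
    · have hlt : i.val < K := by have := i.isLt; omega
      rw [if_neg hi, Finset.sum_eq_single (⟨i.val, hlt⟩ : Fin K)]
      · simp [hS]
      · intro b _ hb
        have : b.val ≠ i.val := fun h => hb (Fin.ext h)
        simp [this]
      · simp

lemma newRel_noRect {K θ : ℕ} (hθ : θ ≤ K + 1) {i₁ i₂ j₁ j₂ : Fin θ} (hi : i₁ ≠ i₂) (hj : j₁ ≠ j₂)
    (h1 : newRel K θ i₁ j₁) (h2 : newRel K θ i₁ j₂) (h3 : newRel K θ i₂ j₁) : False := by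
  unfold newRel at *
  have := i₁.isLt
  have := i₂.isLt
  have := j₁.isLt
  have := j₂.isLt
  split_ifs at * with h
  · exact hj (h1.symm.trans h2)
  · rw [Ne, Fin.ext_iff] at hi hj
    omega


lemma ext_noRect {F : Type*} [Field F] {K θ : ℕ} (hθ : θ ≤ K + 1)
    {S : Finset F} (f : Fin K → Fin K → F) 
    (hd : ∀ a a' b b', a ≠ a' → b ≠ b' → f a b - f a b' ≠ f a' b - f a' b')
    (u₁ u₂ w₁ w₂ : (Fin K × F) ⊕ Fin θ) (hu : u₁ ≠ u₂) (hw : w₁ ≠ w₂)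
    (h1 : extRel K θ S f u₁ w₁) (h2 : extRel K θ S f u₁ w₂)
    (h3 : extRel K θ S f u₂ w₁) (h4 : extRel K θ S f u₂ w₂) : False := by
  rcases u₁ with ⟨a, y⟩ | i <;> rcases u₂ with ⟨a', y'⟩ | i' <;>
    rcases w₁ with ⟨b, c⟩ | j <;> rcases w₂ with ⟨b', c'⟩ | j' <;>
    simp only [extRel, ne_eq, Sum.inl.injEq, Sum.inr.injEq, Prod.mk.injEq] at hu hw h1 h2 h3 h4
  case inl.inl.inl.inl =>
    obtain ⟨h1, -⟩ := h1
    obtain ⟨h2, -⟩ := h2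
    obtain ⟨h3, -⟩ := h3
    obtain ⟨h4, -⟩ := h4
    have haa : a ≠ a' := by
      rintro rfl
      exact hu ⟨rfl, by rw [← h3] at h1; exact sub_left_injective h1⟩
    have hbb : b ≠ b' := by
      rintro rfl
      exact hw ⟨rfl, by rw [← h2] at h1; exact sub_right_injective h1⟩
    apply hd a a' b b' haa hbb
    rw [← h1, ← h2, ← h3, ← h4]; ring
  case inr.inr.inr.inr => exact newRel_noRect hθ hu hw h1 h2 h3
  all_goals grind [newRel]

/-- For every prime power `q`, every `0 ≤ s < q`, every `0 ≤ θ ≤ q - s + 1`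
and every `0 ≤ Δ < q - s`, a symmetric configuration `v_k` with
`v = q² - qs + θ` and `k = q - s - Δ` exists. -/
theorem config_extension_family (q : ℕ) (hq : IsPrimePow q)
    (s θ Δ : ℕ) (hs : s < q) (hθ : θ ≤ q - s + 1) (hΔ : Δ < q - s) :
    ConfigExists (q ^ 2 - q * s + θ) (q - s - Δ) := by
  classical
  obtain ⟨K, rfl⟩ : ∃ K, q = K + s := ⟨q - s, by omega⟩
  have e1 : (K + s) ^ 2 - (K + s) * s = K * (K + s) := by
    rw [pow_two, ← Nat.mul_sub, Nat.add_sub_cancel, mul_comm]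
  rw [e1]
  simp only [Nat.add_sub_cancel] at hθ hΔ ⊢
  apply peel_many Δ
  rw [Nat.sub_add_cancel hΔ.le]
  obtain ⟨p, n, hp, hn, hpn⟩ := hq
  haveI : Fact p.Prime := ⟨hp.nat_prime⟩
  let F := GaloisField p n
  haveI : Fintype F := Fintype.ofFinite F
  have hF : Fintype.card F = K + s := by
    rw [← Nat.card_eq_fintype_card, GaloisField.card p n hn.ne', hpn]
  obtain ⟨e⟩ : Nonempty (Fin K ↪ F) :=
    Function.Embedding.nonempty_of_card_le (by simp [hF])
  obtain ⟨S, -, hS⟩ := Finset.exists_subset_card_eq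
    (show K - 1 ≤ (Finset.univ : Finset F).card by rw [Finset.card_univ, hF]; omega)
  have hS' : S.card + 1 = K := by omega
  let f : Fin K → Fin K → F := fun a b => (e a - e b) * e b
  have hf : ∀ a, f a a = 0 := fun a => by simp [f]
  have hd : ∀ a a' b b', a ≠ a' → b ≠ b' → f a b - f a b' ≠ f a' b - f a' b' := by
    intro a a' b b' ha hb h
    have h0 : (e a - e a') * (e b - e b') = 0 := by
      simp only [f] at h
      linear_combination h
    rcases mul_eq_zero.1 h0 with h | h
    · exact ha (e.injective (sub_eq_zero.1 h))
    · exact hb (e.injective (sub_eq_zero.1 h))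
  have hcard : Fintype.card ((Fin K × F) ⊕ Fin θ) = K * (K + s) + θ := by
    simp [hF]
  refine config_of_types hcard hcard (fun u w => decide (extRel K θ S f u w)) ⟨?_, ?_, ?_⟩
  · intro u
    simp only [decide_eq_true_eq]
    convert ext_row hθ (by omega) hS' f u
  · intro w
    simp only [decide_eq_true_eq, extRel_swap hf]
    convert ext_row hθ (by omega) hS' (fun a b => - f b a) w
  · intro u₁ u₂ w₁ w₂ hu hw h1 h2 h3 h4
    simp only [decide_eq_true_eq] at h1 h2 h3 h4
    exact ext_noRect hθ f hd u₁ u₂ w₁ w₂ hu hw h1 h2 h3 h4
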